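/- arXiv:2201.01063 — 2 statements merged into one kernel-verified Lean document; each statement's English description precedes it below -/
import Mathlib

section
/- Let n ≥ 3 and T ⊆ {1,…,n} with {n−1, n} ⊆ T. If |T| is odd, the geometric realization of the induced subcomplex K''_{χ'',T} is homotopy equivalent to the sphere S^{|T|−1}. If |T| is even, the geometric realization of K''_{χ'',T} is homotopy equivalent to the sphere S^{|T|−2}. -/
/-- The `(i,j)` entry of the characteristic matrix `χ''` of the small cover over
`P₆ × I^{n−2}` (rows `1,…,n`, columns `1,…,2n+2`): row `i` has `1`'s exactly at positions
`i`, `n+1`, `n+1+i` and `2n+2`. -/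
def chi''Entry (n i j : ℕ) : ZMod 2 :=
  if j = i ∨ j = n + 1 ∨ j = n + 1 + i ∨ j = 2 * n + 2 then 1 else 0

/-- The support of `χ''_T = ∑_{i∈T} (row i of χ'')`, as a subset of `{1,…,2n+2}`. -/
def chi''Supp (n : ℕ) (T : Finset ℕ) : Finset ℕ :=
  (Finset.Icc 1 (2 * n + 2)).filter (fun j => (∑ i ∈ T, chi''Entry n i j) ≠ 0)

/-- The vertex set of the 6-cycle `C₆`, in cyclic order `n+1, n−1, n, 2n+2, 2n, 2n+1`. -/
def hexCyc (n : ℕ) : Finset ℕ := {n + 1, n - 1, n, 2 * n + 2, 2 * n, 2 * n + 1}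

/-- The edges of the 6-cycle `C₆` with vertices `n+1, n−1, n, 2n+2, 2n, 2n+1` in cyclic
order. -/
def hexEdges (n : ℕ) : Finset (Finset ℕ) :=
  {{n + 1, n - 1}, {n - 1, n}, {n, 2 * n + 2}, {2 * n + 2, 2 * n}, {2 * n, 2 * n + 1},
   {2 * n + 1, n + 1}}

/-- Faces of `K''`, the simplicial join of the 6-cycle `C₆` (on vertices
`n+1, n−1, n, 2n+2, 2n, 2n+1`) with the boundary complex of the `(n−2)`-dimensional cross
polytope on `{1,…,n−2} ∪ {n+2,…,2n−1}` with antipodal pairs `{i, n+1+i}` (`1 ≤ i ≤ n−2`):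
`t` is a face iff its intersection with the cycle is a face of the cycle (empty, a vertex,
or an edge) and it contains no antipodal pair. -/
def hexFace (n : ℕ) (t : Finset ℕ) : Prop :=
  t ⊆ Finset.Icc 1 (2 * n + 2) ∧
  (∀ i ∈ Finset.Icc 1 (n - 2), ¬(i ∈ t ∧ n + 1 + i ∈ t)) ∧
  (t ∩ hexCyc n = ∅ ∨ (∃ a ∈ hexCyc n, t ∩ hexCyc n = {a}) ∨ t ∩ hexCyc n ∈ hexEdges n)

/-- The geometric realization of an abstract simplicial complex with vertices among
`{0,…,m−1}`, whose faces are given by the predicate `K`: the space of convex weight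
functions whose support is a face of `K`. -/
abbrev GeomReal (m : ℕ) (K : Finset ℕ → Prop) : Type :=
  {f : Fin m → ℝ // (∀ v, 0 ≤ f v) ∧ (∑ v, f v = 1) ∧
    K ((Finset.univ.filter (fun v => f v ≠ 0)).image Fin.val)}


lemma core_equiv {M : ℕ} (K : Finset ℕ → Prop) {E : Type} [NormedAddCommGroup E]
    [NormedSpace ℝ E] (Φ : (Fin M → ℝ) → E) (Ψ : E → (Fin M → ℝ))
    (P : (Fin M → ℝ) → Prop)
    (hPdef : ∀ f, P f ↔ (∀ v, 0 ≤ f v) ∧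
      K ((Finset.univ.filter (fun v => f v ≠ 0)).image Fin.val))
    (hΦ : Continuous Φ) (hΨ : Continuous Ψ)
    (hΦc : ∀ (c : ℝ) f, 0 < c → Φ (c • f) = c • Φ f)
    (hΨc : ∀ (c : ℝ) y, 0 < c → Ψ (c • y) = c • Ψ y)
    (hPΨ : ∀ y, P (Ψ y)) (hid : ∀ y, Φ (Ψ y) = y)
    (hker : ∀ f, P f → Φ f = 0 → f = 0)
    (hline : ∀ f, P f → ∀ a b : ℝ, 0 ≤ a → 0 ≤ b → P (a • f + b • Ψ (Φ f))) :
    Nonempty (ContinuousMap.HomotopyEquiv (GeomReal M K) (Metric.sphere (0 : E) 1)) := by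
  have hΦ0 : Φ 0 = 0 := by
    have := hΦc 2 0 (by norm_num)
    rw [smul_zero, two_smul] at this
    simpa using this
  have hΦne : ∀ f : GeomReal M K, Φ f.1 ≠ 0 := by
    intro f h
    have h0 := hker f.1 ((hPdef _).2 ⟨f.2.1, f.2.2.2⟩) h
    have := f.2.2.1
    rw [h0] at this
    simp at this
  have hΨpos : ∀ y, y ≠ 0 → 0 < ∑ v, Ψ y v := by
    intro y hy
    have hn := ((hPdef _).1 (hPΨ y)).1
    refine lt_of_le_of_ne (Finset.sum_nonneg fun v _ => hn v) ?_
    intro h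
    apply hy
    have h0 : Ψ y = 0 := by
      funext v
      exact (Finset.sum_eq_zero_iff_of_nonneg (fun v _ => hn v)).1 h.symm v (Finset.mem_univ v)
    rw [← hid y, h0, hΦ0]
  have hsne : ∀ y : Metric.sphere (0 : E) 1, y.1 ≠ 0 := fun y h => by
    have := y.2
    rw [h] at this
    simp at this
  let F : C(GeomReal M K, Metric.sphere (0 : E) 1) :=
    ⟨fun f => ⟨‖Φ f.1‖⁻¹ • Φ f.1, by
      have := hΦne f
      simp [norm_smul, this]⟩, by
      refine Continuous.subtype_mk ?_ _
      have h : Continuous fun f : GeomReal M K => Φ f.1 := hΦ.comp continuous_subtype_val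
      exact (h.norm.inv₀ fun f => norm_ne_zero_iff.2 (hΦne f)).smul h⟩
  let G : C(Metric.sphere (0 : E) 1, GeomReal M K) :=
    ⟨fun y => ⟨(∑ v, Ψ y.1 v)⁻¹ • Ψ y.1, by
      have hp := hΨpos y.1 (hsne y)
      have h := hPΨ ((∑ v, Ψ y.1 v)⁻¹ • y.1)
      rw [hΨc _ _ (inv_pos.2 hp), hPdef] at h
      refine ⟨h.1, ?_, h.2⟩
      simp only [Pi.smul_apply, smul_eq_mul, ← Finset.mul_sum]
      exact inv_mul_cancel₀ hp.ne'⟩, by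
      refine Continuous.subtype_mk ?_ _
      have h : Continuous fun y : Metric.sphere (0 : E) 1 => Ψ y.1 :=
        hΨ.comp continuous_subtype_val
      refine Continuous.smul (Continuous.inv₀ ?_ fun y => (hΨpos y.1 (hsne y)).ne') h
      exact continuous_finsetSum _ fun v _ => (continuous_apply v).comp h⟩
  have hGF : ∀ f : GeomReal M K, ∃ b : ℝ, 0 ≤ b ∧ (G (F f)).1 = b • Ψ (Φ f.1) := by
    intro f
    have hc : 0 < ‖Φ f.1‖⁻¹ := inv_pos.2 (norm_pos_iff.2 (hΦne f))
    have hp := hΨpos (F f).1 (hsne _)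
    refine ⟨(∑ v, Ψ (F f).1 v)⁻¹ * ‖Φ f.1‖⁻¹, by positivity, ?_⟩
    rw [mul_smul, ← hΨc _ _ hc]
    rfl
  refine ⟨⟨F, G, ⟨?_⟩, ?_⟩⟩
  · refine
      { toFun := fun p => ⟨(p.1 : ℝ) • p.2.1 + (1 - (p.1 : ℝ)) • (G (F p.2)).1, ?_⟩
        continuous_toFun := ?_
        map_zero_left := ?_
        map_one_left := ?_ }
    · obtain ⟨b, hb, he⟩ := hGF p.2
      have hs := (G (F p.2)).2.2.1
      have hs' := p.2.2.2.1
      have h := hline p.2.1 ((hPdef _).2 ⟨p.2.2.1, p.2.2.2.2⟩) p.1 ((1 - p.1) * b) p.1.2.1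
        (mul_nonneg (by linarith [p.1.2.2]) hb)
      rw [mul_smul, ← he, hPdef] at h
      refine ⟨h.1, ?_, h.2⟩
      simp only [Pi.add_apply, Pi.smul_apply, smul_eq_mul, Finset.sum_add_distrib,
        ← Finset.mul_sum]
      rw [hs, hs']
      ring
    · refine Continuous.subtype_mk ?_ _
      have hc : Continuous fun p : unitInterval × GeomReal M K => (G (F p.2)).1 :=
        continuous_subtype_val.comp (G.continuous.comp (F.continuous.comp continuous_snd))
      have h1 : Continuous fun p : unitInterval × GeomReal M K => (p.1 : ℝ) :=
        continuous_subtype_val.comp continuous_fst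
      have h2 : Continuous fun p : unitInterval × GeomReal M K => p.2.1 :=
        continuous_subtype_val.comp continuous_snd
      exact (h1.smul h2).add ((continuous_const.sub h1).smul hc)
    · intro f
      apply Subtype.ext
      simp
    · intro f
      apply Subtype.ext
      simp
  · have : F.comp G = ContinuousMap.id _ := by
      ext y
      have hp := hΨpos y.1 (hsne y)
      have hy : ‖y.1‖ = 1 := by simpa using y.2
      change ‖Φ ((∑ v, Ψ y.1 v)⁻¹ • Ψ y.1)‖⁻¹ • Φ ((∑ v, Ψ y.1 v)⁻¹ • Ψ y.1) = y.1
      rw [hΦc _ _ (inv_pos.2 hp), hid, norm_smul, hy, smul_smul]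
      rw [Real.norm_of_nonneg (inv_pos.2 hp).le, mul_one, inv_mul_cancel₀ (inv_pos.2 hp).ne',
        one_smul]
    rw [this]

/-- Extension by zero. -/
noncomputable def extF {M : ℕ} (f : Fin M → ℝ) (k : ℕ) : ℝ := if h : k < M then f ⟨k, h⟩ else 0

lemma nat_equiv (M d : ℕ) (K : Finset ℕ → Prop) (S : Finset ℕ) (hS : S.card = d)
    (Q : (ℕ → ℝ) → Prop)
    (hQ : ∀ g : ℕ → ℝ, (∀ k, M ≤ k → g k = 0) → ∀ s : Finset ℕ, (∀ k, k ∈ s ↔ g k ≠ 0) →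
      (((∀ k, 0 ≤ g k) ∧ K s) ↔ Q g))
    (hQ0 : ∀ g, Q g → ∀ k, M ≤ k → g k = 0)
    (φ ψ : (ℕ → ℝ) → (ℕ → ℝ)) (hφ : Continuous φ) (hψ : Continuous ψ)
    (hφc : ∀ (c : ℝ) f, 0 < c → φ (c • f) = c • φ f)
    (hψc : ∀ (c : ℝ) f, 0 < c → ψ (c • f) = c • ψ f)
    (hQψ : ∀ y, (∀ k, k ∉ S → y k = 0) → Q (ψ y))
    (hid : ∀ y, (∀ k, k ∉ S → y k = 0) → ∀ k ∈ S, φ (ψ y) k = y k)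
    (hsupp : ∀ g k, k ∉ S → φ g k = 0)
    (hker : ∀ g, Q g → φ g = 0 → g = 0)
    (hline : ∀ g, Q g → ∀ a b : ℝ, 0 ≤ a → 0 ≤ b → Q (a • g + b • ψ (φ g))) :
    Nonempty (ContinuousMap.HomotopyEquiv (GeomReal M K)
      (Metric.sphere (0 : EuclideanSpace ℝ (Fin d)) 1)) := by
  classical
  let e : S ≃ Fin d := Finset.equivFinOfCardEq hS
  let X : EuclideanSpace ℝ (Fin d) → ℕ → ℝ := fun y k => if h : k ∈ S then y (e ⟨k, h⟩) else 0
  have hXc : Continuous X := by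
    refine continuous_pi fun k => ?_
    by_cases h : k ∈ S
    · simp only [X, h, dite_true]; fun_prop
    · simp only [X, h, dite_false]; fun_prop
  have hX0 : ∀ y k, k ∉ S → X y k = 0 := fun y k h => by simp [X, h]
  have hXs : ∀ (c : ℝ) y, X (c • y) = c • X y := by
    intro c y; funext k
    by_cases h : k ∈ S <;> simp [X, h]
  have hec : Continuous (extF : (Fin M → ℝ) → ℕ → ℝ) := by
    refine continuous_pi fun k => ?_
    by_cases h : k < M
    · simp only [extF, h, dite_true]; fun_prop
    · simp only [extF, h, dite_false]; fun_prop
  have hes : ∀ (c : ℝ) (f : Fin M → ℝ), extF (c • f) = c • extF f := by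
    intro c y; funext k
    by_cases h : k < M <;> simp [extF, h]
  have hea : ∀ (f g : Fin M → ℝ), extF (f + g) = extF f + extF g := by
    intro c y; funext k
    by_cases h : k < M <;> simp [extF, h]
  have he0 : ∀ (f : Fin M → ℝ) k, M ≤ k → extF f k = 0 := fun f k h => by
    simp [extF, h]
  have hev : ∀ (f : Fin M → ℝ) (v : Fin M), extF f v = f v := fun f k => by
    simp [extF]
  have her : ∀ g : ℕ → ℝ, (∀ k, M ≤ k → g k = 0) → extF (fun v : Fin M => g v) = g := by
    intro g hg; funext k
    by_cases h : k < M
    · simp [extF, h]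
    · simp [extF, h, hg k (by omega)]
  let Φ : (Fin M → ℝ) → EuclideanSpace ℝ (Fin d) :=
    fun f => WithLp.toLp 2 (fun j => φ (extF f) (e.symm j))
  let Ψ : EuclideanSpace ℝ (Fin d) → (Fin M → ℝ) := fun y v => ψ (X y) v
  have hXΦ : ∀ f, X (Φ f) = φ (extF f) := by
    intro f; funext k
    by_cases h : k ∈ S
    · simp [X, Φ, h]
    · simp [X, h, hsupp]
  have heΨ : ∀ y, extF (Ψ y) = ψ (X y) := fun y => her _ (hQ0 _ (hQψ _ (hX0 y)))
  refine core_equiv K Φ Ψ (fun f => Q (extF f)) ?_ ?_ ?_ ?_ ?_ ?_ ?_ ?_ ?_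
  · intro f
    rw [← hQ (extF f) (he0 f) ((Finset.univ.filter (fun v => f v ≠ 0)).image Fin.val)]
    · refine and_congr_left fun _ => ⟨fun h v => ?_, fun h k => ?_⟩
      · rw [← hev f]; exact h v
      · by_cases hk : k < M
        · simpa [extF, hk] using h ⟨k, hk⟩
        · simp [extF, hk]
    · intro k
      by_cases hk : k < M
      · simp only [Finset.mem_image, Finset.mem_filter, Finset.mem_univ, true_and, extF, hk,
          dite_true]
        constructor
        · rintro ⟨v, hv, rfl⟩; exact hv
        · intro h; exact ⟨_, h, rfl⟩
      · simp only [Finset.mem_image, Finset.mem_filter, Finset.mem_univ, true_and, extF, hk,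
          dite_false]
        constructor
        · rintro ⟨v, hv, rfl⟩; exact absurd v.2 hk
        · intro h; exact absurd rfl h
  · have h : Continuous fun f : Fin M → ℝ => φ (extF f) := hφ.comp hec
    refine (PiLp.continuous_toLp 2 _).comp (continuous_pi fun j => ?_)
    exact (continuous_apply _).comp h
  · refine continuous_pi fun v => ?_
    exact (continuous_apply _).comp (hψ.comp hXc)
  · intro c f hc
    ext j
    simp [Φ, hes, hφc c _ hc]
  · intro c y hc
    funext v
    simp [Ψ, hXs, hψc c _ hc]
  · intro y
    simp only [heΨ]
    exact hQψ _ (hX0 y)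
  · intro y
    ext j
    have := hid (X y) (hX0 y) (e.symm j) (e.symm j).2
    simp only [Φ, heΨ]
    rw [this]
    simp [X]
  · intro f hf h
    have h0 : φ (extF f) = 0 := by
      rw [← hXΦ, h]; funext k; simp [X]
    have h1 := hker _ hf h0
    funext v
    rw [← hev f, h1]; rfl
  · intro f hf a b ha hb
    simp only [hea, hes, heΨ, hXΦ]
    exact hline _ hf a b ha hb

lemma mem_chi (n : ℕ) (hn : 3 ≤ n) (T : Finset ℕ) (hT : T ⊆ Finset.Icc 1 n) (k : ℕ) :
    k ∈ chi''Supp n T ↔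
      k ∈ T ∨ (n + 1 ≤ k ∧ k - (n + 1) ∈ T) ∨ (¬ Even T.card ∧ (k = n + 1 ∨ k = 2 * n + 2)) := by
  have hT' : ∀ i ∈ T, 1 ≤ i ∧ i ≤ n := fun i hi => Finset.mem_Icc.1 (hT hi)
  by_cases h : k = n + 1 ∨ k = 2 * n + 2
  · have hs : ∑ i ∈ T, chi''Entry n i k = (T.card : ZMod 2) := by
      rw [Finset.sum_congr rfl (g := fun _ => (1 : ZMod 2))]
      · simp
      · intro i _
        unfold chi''Entry
        rw [if_pos]; tauto
    have hk1 : k ∉ T := fun hk => by have := hT' k hk; omega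
    have hk2 : k - (n + 1) ∉ T := fun hk => by have := hT' _ hk; omega
    have hI : k ∈ Finset.Icc 1 (2 * n + 2) := by rw [Finset.mem_Icc]; omega
    simp only [chi''Supp, Finset.mem_filter, hs, hI, hk1, hk2, h, ne_eq,
      ZMod.natCast_eq_zero_iff_even, true_and, and_false, false_or, and_true]
  · have hs : ∑ i ∈ T, chi''Entry n i k =
        if k ∈ T ∨ (n + 1 ≤ k ∧ k - (n + 1) ∈ T) then 1 else 0 := by
      split_ifs with hk
      · rw [Finset.sum_eq_single (if k ≤ n then k else k - (n + 1))]
        · unfold chi''Entry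
          rw [if_pos]
          split_ifs with h2
          · simp
          · omega
        · intro i hi hne
          have := hT' i hi
          unfold chi''Entry
          rw [if_neg]
          split_ifs at hne <;> omega
        · intro hne
          exfalso; apply hne
          rcases hk with hk | hk
          · rw [if_pos (hT' k hk).2]; exact hk
          · rw [if_neg (by omega)]; exact hk.2
      · refine Finset.sum_eq_zero fun i hi => ?_
        unfold chi''Entry
        rw [if_neg]
        rintro (rfl | h3 | rfl | h3)
        · exact hk (Or.inl hi)
        · omega
        · exact hk (Or.inr ⟨by omega, by simpa using hi⟩)
        · omega
    simp only [chi''Supp, Finset.mem_filter, hs, h, and_false, or_false]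
    constructor
    · intro h1
      by_contra h2
      rw [if_neg h2] at h1
      exact h1.2 rfl
    · intro h1
      refine ⟨?_, by rw [if_pos h1]; exact one_ne_zero⟩
      rw [Finset.mem_Icc]
      rcases h1 with h1 | h1
      · have := hT' _ h1; omega
      · have := hT' _ h1.2; omega

set_option maxHeartbeats 2000000 in
lemma hex_iff (n : ℕ) (hn : 3 ≤ n) (s : Finset ℕ) :
    (s ∩ hexCyc n = ∅ ∨ (∃ a ∈ hexCyc n, s ∩ hexCyc n = {a}) ∨ s ∩ hexCyc n ∈ hexEdges n) ↔
    (¬ (n + 1 ∈ s ∧ n ∈ s) ∧ ¬ (n + 1 ∈ s ∧ 2 * n + 2 ∈ s) ∧ ¬ (n + 1 ∈ s ∧ 2 * n ∈ s) ∧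
     ¬ (n - 1 ∈ s ∧ 2 * n + 2 ∈ s) ∧ ¬ (n - 1 ∈ s ∧ 2 * n ∈ s) ∧ ¬ (n - 1 ∈ s ∧ 2 * n + 1 ∈ s) ∧
     ¬ (n ∈ s ∧ 2 * n ∈ s) ∧ ¬ (n ∈ s ∧ 2 * n + 1 ∈ s) ∧ ¬ (2 * n + 2 ∈ s ∧ 2 * n + 1 ∈ s)) := by
  have key : ∀ x y, x ∈ hexCyc n → y ∈ hexCyc n → x ≠ y → ({x, y} : Finset ℕ) ∉ hexEdges n →
      (s ∩ hexCyc n = ∅ ∨ (∃ a ∈ hexCyc n, s ∩ hexCyc n = {a}) ∨ s ∩ hexCyc n ∈ hexEdges n) →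
      ¬ (x ∈ s ∧ y ∈ s) := by
    rintro x y hx hy hne he h ⟨hxs, hys⟩
    have hx' : x ∈ s ∩ hexCyc n := Finset.mem_inter.2 ⟨hxs, hx⟩
    have hy' : y ∈ s ∩ hexCyc n := Finset.mem_inter.2 ⟨hys, hy⟩
    rcases h with h | ⟨a, _, h⟩ | h
    · rw [h] at hx'; simp at hx'
    · rw [h, Finset.mem_singleton] at hx' hy'; exact hne (hx'.trans hy'.symm)
    · apply he
      have hc : (s ∩ hexCyc n).card ≤ 2 := by
        simp only [hexEdges, Finset.mem_insert, Finset.mem_singleton] at h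
        rcases h with h | h | h | h | h | h <;> rw [h] <;> exact Finset.card_le_two
      have : ({x, y} : Finset ℕ) = s ∩ hexCyc n := by
        apply Finset.eq_of_subset_of_card_le
        · intro z hz
          simp only [Finset.mem_insert, Finset.mem_singleton] at hz
          rcases hz with rfl | rfl <;> assumption
        · rw [Finset.card_pair hne]; exact hc
      rw [this]; exact h
  have nedge : ∀ x y, (({x, y} : Finset ℕ) ∈ hexEdges n) → x ≠ y → 
      ((x = n+1 ∧ y = n-1) ∨ (x = n-1 ∧ y = n+1) ∨ (x = n-1 ∧ y = n) ∨ (x = n ∧ y = n-1) ∨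
       (x = n ∧ y = 2*n+2) ∨ (x = 2*n+2 ∧ y = n) ∨ (x = 2*n+2 ∧ y = 2*n) ∨ (x = 2*n ∧ y = 2*n+2) ∨
       (x = 2*n ∧ y = 2*n+1) ∨ (x = 2*n+1 ∧ y = 2*n) ∨ (x = 2*n+1 ∧ y = n+1) ∨
       (x = n+1 ∧ y = 2*n+1)) := by
    intro x y h hne
    simp only [hexEdges, Finset.mem_insert, Finset.mem_singleton] at h
    rcases h with h | h | h | h | h | h <;>
    · have h1 : x ∈ ({x, y} : Finset ℕ) := by simp
      have h2 : y ∈ ({x, y} : Finset ℕ) := by simp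
      rw [h] at h1 h2
      simp only [Finset.mem_insert, Finset.mem_singleton] at h1 h2
      rcases h1 with h1 | h1 <;> rcases h2 with h2 | h2 <;>
        first
        | exact absurd (h1.trans h2.symm) hne
        | simp [h1, h2]
  constructor
  · intro h
    refine ⟨?_, ?_, ?_, ?_, ?_, ?_, ?_, ?_, ?_⟩ <;>
      refine key _ _ (by simp [hexCyc]) (by simp [hexCyc]) (by omega)
        (fun h => by have := nedge _ _ h (by omega); omega) h
  · rintro ⟨p1, p2, p3, p4, p5, p6, p7, p8, p9⟩
    have hmem : ∀ k, k ∈ s ∩ hexCyc n ↔ (k = n + 1 ∧ n + 1 ∈ s) ∨ (k = n - 1 ∧ n - 1 ∈ s) ∨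
        (k = n ∧ n ∈ s) ∨ (k = 2 * n + 2 ∧ 2 * n + 2 ∈ s) ∨ (k = 2 * n ∧ 2 * n ∈ s) ∨
        (k = 2 * n + 1 ∧ 2 * n + 1 ∈ s) := by
      intro k
      simp only [hexCyc, Finset.mem_inter, Finset.mem_insert, Finset.mem_singleton]
      constructor
      · rintro ⟨hk, rfl | rfl | rfl | rfl | rfl | rfl⟩ <;> simp [hk]
      · rintro (⟨rfl, hk⟩ | ⟨rfl, hk⟩ | ⟨rfl, hk⟩ | ⟨rfl, hk⟩ | ⟨rfl, hk⟩ | ⟨rfl, hk⟩) <;> simp [hk]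
    have hE : ∀ x y, ({x, y} : Finset ℕ) ∈ hexEdges n → x ∈ hexCyc n → y ∈ hexCyc n →
        (∀ k ∈ s ∩ hexCyc n, k = x ∨ k = y) →
        (s ∩ hexCyc n = ∅ ∨ (∃ a ∈ hexCyc n, s ∩ hexCyc n = {a}) ∨
          s ∩ hexCyc n ∈ hexEdges n) := by
      intro x y he hx hy h
      have hsub : s ∩ hexCyc n ⊆ {x, y} := fun k hk => by simpa using h k hk
      by_cases hx' : x ∈ s ∩ hexCyc n
      · by_cases hy' : y ∈ s ∩ hexCyc n
        · right; right
          have : s ∩ hexCyc n = {x, y} := Finset.Subset.antisymm hsub (by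
            intro z hz
            simp only [Finset.mem_insert, Finset.mem_singleton] at hz
            rcases hz with rfl | rfl <;> assumption)
          rw [this]; exact he
        · right; left
          refine ⟨x, hx, Finset.eq_singleton_iff_unique_mem.2 ⟨hx', fun k hk => ?_⟩⟩
          rcases h k hk with h | h
          · exact h
          · rw [h] at hk; exact absurd hk hy'
      · by_cases hy' : y ∈ s ∩ hexCyc n
        · right; left
          refine ⟨y, hy, Finset.eq_singleton_iff_unique_mem.2 ⟨hy', fun k hk => ?_⟩⟩
          rcases h k hk with h | h
          · rw [h] at hk; exact absurd hk hx'
          · exact h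
        · left
          refine Finset.eq_empty_of_forall_notMem fun k hk => ?_
          rcases h k hk with h | h <;> rw [h] at hk <;> contradiction
    by_cases a1 : n + 1 ∈ s
    · by_cases a2 : n - 1 ∈ s
      · exact hE (n + 1) (n - 1) (by simp [hexEdges]) (by simp [hexCyc]) (by simp [hexCyc])
          (fun k hk => by
              rw [hmem] at hk
              rcases hk with ⟨h, h'⟩ | ⟨h, h'⟩ | ⟨h, h'⟩ | ⟨h, h'⟩ | ⟨h, h'⟩ | ⟨h, h'⟩ <;>
                first
                | exact Or.inl h
                | exact Or.inr h
                | exact absurd h' (by assumption)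
                | exact (p1 ⟨by assumption, by assumption⟩).elim
                | exact (p2 ⟨by assumption, by assumption⟩).elim
                | exact (p3 ⟨by assumption, by assumption⟩).elim
                | exact (p4 ⟨by assumption, by assumption⟩).elim
                | exact (p5 ⟨by assumption, by assumption⟩).elim
                | exact (p6 ⟨by assumption, by assumption⟩).elim
                | exact (p7 ⟨by assumption, by assumption⟩).elim
                | exact (p8 ⟨by assumption, by assumption⟩).elim
                | exact (p9 ⟨by assumption, by assumption⟩).elim)
      · exact hE (2 * n + 1) (n + 1) (by simp [hexEdges]) (by simp [hexCyc]) (by simp [hexCyc])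
          (fun k hk => by
              rw [hmem] at hk
              rcases hk with ⟨h, h'⟩ | ⟨h, h'⟩ | ⟨h, h'⟩ | ⟨h, h'⟩ | ⟨h, h'⟩ | ⟨h, h'⟩ <;>
                first
                | exact Or.inl h
                | exact Or.inr h
                | exact absurd h' (by assumption)
                | exact (p1 ⟨by assumption, by assumption⟩).elim
                | exact (p2 ⟨by assumption, by assumption⟩).elim
                | exact (p3 ⟨by assumption, by assumption⟩).elim
                | exact (p4 ⟨by assumption, by assumption⟩).elim
                | exact (p5 ⟨by assumption, by assumption⟩).elim
                | exact (p6 ⟨by assumption, by assumption⟩).elim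
                | exact (p7 ⟨by assumption, by assumption⟩).elim
                | exact (p8 ⟨by assumption, by assumption⟩).elim
                | exact (p9 ⟨by assumption, by assumption⟩).elim)
    · by_cases a3 : n ∈ s
      · by_cases a2 : n - 1 ∈ s
        · exact hE (n - 1) n (by simp [hexEdges]) (by simp [hexCyc]) (by simp [hexCyc])
            (fun k hk => by
              rw [hmem] at hk
              rcases hk with ⟨h, h'⟩ | ⟨h, h'⟩ | ⟨h, h'⟩ | ⟨h, h'⟩ | ⟨h, h'⟩ | ⟨h, h'⟩ <;>
                first
                | exact Or.inl h
                | exact Or.inr h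
                | exact absurd h' (by assumption)
                | exact (p1 ⟨by assumption, by assumption⟩).elim
                | exact (p2 ⟨by assumption, by assumption⟩).elim
                | exact (p3 ⟨by assumption, by assumption⟩).elim
                | exact (p4 ⟨by assumption, by assumption⟩).elim
                | exact (p5 ⟨by assumption, by assumption⟩).elim
                | exact (p6 ⟨by assumption, by assumption⟩).elim
                | exact (p7 ⟨by assumption, by assumption⟩).elim
                | exact (p8 ⟨by assumption, by assumption⟩).elim
                | exact (p9 ⟨by assumption, by assumption⟩).elim)
        · exact hE n (2 * n + 2) (by simp [hexEdges]) (by simp [hexCyc]) (by simp [hexCyc])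
            (fun k hk => by
              rw [hmem] at hk
              rcases hk with ⟨h, h'⟩ | ⟨h, h'⟩ | ⟨h, h'⟩ | ⟨h, h'⟩ | ⟨h, h'⟩ | ⟨h, h'⟩ <;>
                first
                | exact Or.inl h
                | exact Or.inr h
                | exact absurd h' (by assumption)
                | exact (p1 ⟨by assumption, by assumption⟩).elim
                | exact (p2 ⟨by assumption, by assumption⟩).elim
                | exact (p3 ⟨by assumption, by assumption⟩).elim
                | exact (p4 ⟨by assumption, by assumption⟩).elim
                | exact (p5 ⟨by assumption, by assumption⟩).elim
                | exact (p6 ⟨by assumption, by assumption⟩).elim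
                | exact (p7 ⟨by assumption, by assumption⟩).elim
                | exact (p8 ⟨by assumption, by assumption⟩).elim
                | exact (p9 ⟨by assumption, by assumption⟩).elim)
      · by_cases a2 : n - 1 ∈ s
        · exact hE (n - 1) n (by simp [hexEdges]) (by simp [hexCyc]) (by simp [hexCyc])
            (fun k hk => by
              rw [hmem] at hk
              rcases hk with ⟨h, h'⟩ | ⟨h, h'⟩ | ⟨h, h'⟩ | ⟨h, h'⟩ | ⟨h, h'⟩ | ⟨h, h'⟩ <;>
                first
                | exact Or.inl h
                | exact Or.inr h
                | exact absurd h' (by assumption)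
                | exact (p1 ⟨by assumption, by assumption⟩).elim
                | exact (p2 ⟨by assumption, by assumption⟩).elim
                | exact (p3 ⟨by assumption, by assumption⟩).elim
                | exact (p4 ⟨by assumption, by assumption⟩).elim
                | exact (p5 ⟨by assumption, by assumption⟩).elim
                | exact (p6 ⟨by assumption, by assumption⟩).elim
                | exact (p7 ⟨by assumption, by assumption⟩).elim
                | exact (p8 ⟨by assumption, by assumption⟩).elim
                | exact (p9 ⟨by assumption, by assumption⟩).elim)
        · by_cases a4 : 2 * n + 2 ∈ s
          · exact hE (2 * n + 2) (2 * n) (by simp [hexEdges]) (by simp [hexCyc])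
              (by simp [hexCyc]) (fun k hk => by
              rw [hmem] at hk
              rcases hk with ⟨h, h'⟩ | ⟨h, h'⟩ | ⟨h, h'⟩ | ⟨h, h'⟩ | ⟨h, h'⟩ | ⟨h, h'⟩ <;>
                first
                | exact Or.inl h
                | exact Or.inr h
                | exact absurd h' (by assumption)
                | exact (p1 ⟨by assumption, by assumption⟩).elim
                | exact (p2 ⟨by assumption, by assumption⟩).elim
                | exact (p3 ⟨by assumption, by assumption⟩).elim
                | exact (p4 ⟨by assumption, by assumption⟩).elim
                | exact (p5 ⟨by assumption, by assumption⟩).elim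
                | exact (p6 ⟨by assumption, by assumption⟩).elim
                | exact (p7 ⟨by assumption, by assumption⟩).elim
                | exact (p8 ⟨by assumption, by assumption⟩).elim
                | exact (p9 ⟨by assumption, by assumption⟩).elim)
          · exact hE (2 * n) (2 * n + 1) (by simp [hexEdges]) (by simp [hexCyc])
              (by simp [hexCyc]) (fun k hk => by
              rw [hmem] at hk
              rcases hk with ⟨h, h'⟩ | ⟨h, h'⟩ | ⟨h, h'⟩ | ⟨h, h'⟩ | ⟨h, h'⟩ | ⟨h, h'⟩ <;>
                first
                | exact Or.inl h
                | exact Or.inr h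
                | exact absurd h' (by assumption)
                | exact (p1 ⟨by assumption, by assumption⟩).elim
                | exact (p2 ⟨by assumption, by assumption⟩).elim
                | exact (p3 ⟨by assumption, by assumption⟩).elim
                | exact (p4 ⟨by assumption, by assumption⟩).elim
                | exact (p5 ⟨by assumption, by assumption⟩).elim
                | exact (p6 ⟨by assumption, by assumption⟩).elim
                | exact (p7 ⟨by assumption, by assumption⟩).elim
                | exact (p8 ⟨by assumption, by assumption⟩).elim
                | exact (p9 ⟨by assumption, by assumption⟩).elim)

/-- The cone over the realization, in terms of functions on `ℕ`. -/
def QQ (n : ℕ) (T : Finset ℕ) (g : ℕ → ℝ) : Prop :=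
  (∀ k, 0 ≤ g k) ∧
  (∀ k, ¬ (k ∈ T ∨ (n + 1 ≤ k ∧ k - (n + 1) ∈ T) ∨
    (¬ Even T.card ∧ (k = n + 1 ∨ k = 2 * n + 2))) → g k = 0) ∧
  (∀ i, 1 ≤ i → i ≤ n - 2 → (g i = 0 ∨ g (n + 1 + i) = 0)) ∧
  (g (n + 1) = 0 ∨ g n = 0) ∧ (g (n + 1) = 0 ∨ g (2 * n + 2) = 0) ∧
  (g (n + 1) = 0 ∨ g (2 * n) = 0) ∧ (g (n - 1) = 0 ∨ g (2 * n + 2) = 0) ∧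
  (g (n - 1) = 0 ∨ g (2 * n) = 0) ∧ (g (n - 1) = 0 ∨ g (2 * n + 1) = 0) ∧
  (g n = 0 ∨ g (2 * n) = 0) ∧ (g n = 0 ∨ g (2 * n + 1) = 0) ∧
  (g (2 * n + 2) = 0 ∨ g (2 * n + 1) = 0)

lemma QQ_iff (n : ℕ) (hn : 3 ≤ n) (T : Finset ℕ) (hT : T ⊆ Finset.Icc 1 n) (g : ℕ → ℝ)
    (s : Finset ℕ) (hs : ∀ k, k ∈ s ↔ g k ≠ 0) :
    ((∀ k, 0 ≤ g k) ∧ (hexFace n s ∧ s ⊆ chi''Supp n T)) ↔ QQ n T g := by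
  unfold hexFace QQ
  rw [hex_iff n hn s]
  simp only [hs, ne_eq]
  have nn : ∀ a b : ℝ, ¬ (¬ a = 0 ∧ ¬ b = 0) ↔ (a = 0 ∨ b = 0) := fun a b => by tauto
  simp only [nn]
  have h1 : s ⊆ chi''Supp n T ↔ (∀ k, ¬ (k ∈ T ∨ (n + 1 ≤ k ∧ k - (n + 1) ∈ T) ∨
    (¬ Even T.card ∧ (k = n + 1 ∨ k = 2 * n + 2))) → g k = 0) := by
    constructor
    · intro h k hk
      rw [← mem_chi n hn T hT] at hk
      by_contra h0
      exact hk (h ((hs k).2 h0))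
    · intro h k hk
      rw [mem_chi n hn T hT]
      by_contra h0
      exact (hs k).1 hk (h k h0)
  have h2 : s ⊆ chi''Supp n T → s ⊆ Finset.Icc 1 (2 * n + 2) :=
    fun h => h.trans (Finset.filter_subset _ _)
  have h3 : (∀ i ∈ Finset.Icc 1 (n - 2), (g i = 0 ∨ g (n + 1 + i) = 0)) ↔
      (∀ i, 1 ≤ i → i ≤ n - 2 → (g i = 0 ∨ g (n + 1 + i) = 0)) := by
    simp [Finset.mem_Icc]
  rw [← h1, h3]
  exact ⟨fun ⟨a, ⟨_, c, d⟩, e⟩ => ⟨a, e, c, d⟩, fun ⟨a, e, c, d⟩ => ⟨a, ⟨h2 e, c, d⟩, e⟩⟩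

/-- Positive part. -/
noncomputable def pp (x : ℝ) : ℝ := max 0 x
/-- Coefficient of a coordinate vertex of the hexagon. -/
noncomputable def hx (x w : ℝ) : ℝ := max 0 (min x (x + w))
/-- Coefficient of a mixed vertex of the hexagon. -/
noncomputable def mn (x w : ℝ) : ℝ := max 0 (min x (-w))

lemma pp_nonneg (x : ℝ) : 0 ≤ pp x := le_max_left _ _
lemma hx_nonneg (x w : ℝ) : 0 ≤ hx x w := le_max_left _ _
lemma mn_nonneg (x w : ℝ) : 0 ≤ mn x w := le_max_left _ _
lemma pp_mul (c x : ℝ) (hc : 0 < c) : pp (c * x) = c * pp x := by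
  unfold pp; rw [mul_max_of_nonneg _ _ hc.le, mul_zero]
lemma hx_mul (c x w : ℝ) (hc : 0 < c) : hx (c * x) (c * w) = c * hx x w := by
  unfold hx; rw [mul_max_of_nonneg _ _ hc.le, mul_min_of_nonneg _ _ hc.le, mul_zero, mul_add]
lemma mn_mul (c x w : ℝ) (hc : 0 < c) : mn (c * x) (c * w) = c * mn x w := by
  unfold mn; rw [mul_max_of_nonneg _ _ hc.le, mul_min_of_nonneg _ _ hc.le, mul_zero, mul_neg]
lemma pp_cont : Continuous pp := by unfold pp; fun_prop
lemma hx_cont : Continuous fun p : ℝ × ℝ => hx p.1 p.2 := by unfold hx; fun_prop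
lemma mn_cont : Continuous fun p : ℝ × ℝ => mn p.1 p.2 := by unfold mn; fun_prop
lemma pp_sub (x : ℝ) : pp x - pp (-x) = x := by
  unfold pp; grind
lemma pp_or (x : ℝ) : pp x = 0 ∨ pp (-x) = 0 := by
  unfold pp; grind
lemma pp_zero : pp 0 = 0 := by simp [pp]
lemma pp_pair (a b : ℝ) (ha : 0 ≤ a) (hb : 0 ≤ b) (h : a = 0 ∨ b = 0) :
    pp (a - b) = a ∧ pp (-(a - b)) = b := by
  unfold pp; grind
lemma hex_x (x w : ℝ) : hx x w - hx (-x) (-w) + mn x w - mn w x = x := by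
  unfold hx mn; grind
lemma hex_w (x w : ℝ) : hx w x - hx (-w) (-x) - mn x w + mn w x = w := by
  unfold hx mn; grind
lemma hex_or (x w : ℝ) : 
  (mn x w = 0 ∨ hx w x = 0) ∧ (mn x w = 0 ∨ mn w x = 0) ∧
  (mn x w = 0 ∨ hx (-x) (-w) = 0) ∧ (hx x w = 0 ∨ mn w x = 0) ∧
  (hx x w = 0 ∨ hx (-x) (-w) = 0) ∧ (hx x w = 0 ∨ hx (-w) (-x) = 0) ∧
  (hx w x = 0 ∨ hx (-x) (-w) = 0) ∧ (hx w x = 0 ∨ hx (-w) (-x) = 0) ∧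
  (mn w x = 0 ∨ hx (-w) (-x) = 0) := by
  unfold hx mn
  refine ⟨?_, ?_, ?_, ?_, ?_, ?_, ?_, ?_, ?_⟩ <;> grind
lemma hex_inv (a b c d e f : ℝ) (ha : 0 ≤ a) (hb : 0 ≤ b) (hc : 0 ≤ c) (hd : 0 ≤ d)
    (he : 0 ≤ e) (hf : 0 ≤ f)
    (h : (a = 0 ∨ c = 0) ∧ (a = 0 ∨ d = 0) ∧ (a = 0 ∨ e = 0) ∧ (b = 0 ∨ d = 0) ∧
      (b = 0 ∨ e = 0) ∧ (b = 0 ∨ f = 0) ∧ (c = 0 ∨ e = 0) ∧ (c = 0 ∨ f = 0) ∧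
      (d = 0 ∨ f = 0)) (x w : ℝ) (hx' : x = b - e + a - d) (hw' : w = c - f - a + d) :
    mn x w = a ∧ hx x w = b ∧ hx w x = c ∧ mn w x = d ∧ hx (-x) (-w) = e ∧
      hx (-w) (-x) = f := by
  have : (c = 0 ∧ d = 0 ∧ e = 0 ∧ f = 0) ∨ (a = 0 ∧ d = 0 ∧ e = 0 ∧ f = 0) ∨
    (a = 0 ∧ b = 0 ∧ e = 0 ∧ f = 0) ∨ (a = 0 ∧ b = 0 ∧ c = 0 ∧ f = 0) ∨
    (a = 0 ∧ b = 0 ∧ c = 0 ∧ d = 0) ∨ (e = 0 ∧ b = 0 ∧ c = 0 ∧ d = 0) := by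
    grind
  unfold hx mn
  rcases this with h | h | h | h | h | h <;> obtain ⟨h1, h2, h3, h4⟩ := h <;>
    refine ⟨?_, ?_, ?_, ?_, ?_, ?_⟩ <;> grind

/-- Forward map, odd case. -/
noncomputable def phiO (n : ℕ) (T : Finset ℕ) (g : ℕ → ℝ) (i : ℕ) : ℝ :=
  if i ∈ T then
    if i = n - 1 then g (n - 1) - g (2 * n) + g (n + 1) - g (2 * n + 2)
    else if i = n then g n - g (2 * n + 1) - g (n + 1) + g (2 * n + 2)
    else g i - g (n + 1 + i)
  else 0

/-- Backward map, odd case. -/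
noncomputable def psiO (n : ℕ) (y : ℕ → ℝ) (k : ℕ) : ℝ :=
  if k = n - 1 then hx (y (n - 1)) (y n)
  else if k = n then hx (y n) (y (n - 1))
  else if k = n + 1 then mn (y (n - 1)) (y n)
  else if k = 2 * n then hx (-y (n - 1)) (-y n)
  else if k = 2 * n + 1 then hx (-y n) (-y (n - 1))
  else if k = 2 * n + 2 then mn (y n) (y (n - 1))
  else if k ≤ n then pp (y k) else pp (-y (k - (n + 1)))

/-- Forward map, even case. -/
noncomputable def phiE (n : ℕ) (T : Finset ℕ) (g : ℕ → ℝ) (i : ℕ) : ℝ :=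
  if i ∈ T.erase n then
    if i = n - 1 then (g (n - 1) + g n) - (g (2 * n) + g (2 * n + 1))
    else g i - g (n + 1 + i)
  else 0

/-- Backward map, even case. -/
noncomputable def psiE (n : ℕ) (y : ℕ → ℝ) (k : ℕ) : ℝ :=
  if k = n ∨ k = 2 * n + 1 then 0
  else if k ≤ n then pp (y k) else pp (-y (k - (n + 1)))

lemma QQ_zero (n : ℕ) (T : Finset ℕ) (hT : T ⊆ Finset.Icc 1 n) (g : ℕ → ℝ) (h : QQ n T g) (k : ℕ)
    (hk : 2 * n + 3 ≤ k) : g k = 0 := by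
  apply h.2.1
  have hT' : ∀ i ∈ T, 1 ≤ i ∧ i ≤ n := fun i hi => Finset.mem_Icc.1 (hT hi)
  rintro (h | h | h)
  · have := hT' _ h; omega
  · have := hT' _ h.2; omega
  · omega

lemma phiO_cont (n : ℕ) (T : Finset ℕ) : Continuous (phiO n T) := by
  refine continuous_pi fun i => ?_
  unfold phiO
  split_ifs <;> fun_prop

lemma phiE_cont (n : ℕ) (T : Finset ℕ) : Continuous (phiE n T) := by
  refine continuous_pi fun i => ?_
  unfold phiE
  split_ifs <;> fun_prop

lemma psiO_cont (n : ℕ) : Continuous (psiO n) := by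
  refine continuous_pi fun i => ?_
  have h0 := pp_cont
  unfold psiO hx mn
  split_ifs <;> fun_prop

lemma psiE_cont (n : ℕ) : Continuous (psiE n) := by
  refine continuous_pi fun i => ?_
  have h0 := pp_cont
  unfold psiE
  split_ifs <;> fun_prop

lemma phiO_mul (n : ℕ) (T : Finset ℕ) (c : ℝ) (g : ℕ → ℝ) : phiO n T (c • g) = c • phiO n T g := by
  funext i
  simp only [phiO, Pi.smul_apply, smul_eq_mul]
  split_ifs <;> ring

lemma phiE_mul (n : ℕ) (T : Finset ℕ) (c : ℝ) (g : ℕ → ℝ) : phiE n T (c • g) = c • phiE n T g := by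
  funext i
  simp only [phiE, Pi.smul_apply, smul_eq_mul]
  split_ifs <;> ring

lemma psiO_mul (n : ℕ) (c : ℝ) (hc : 0 < c) (g : ℕ → ℝ) : psiO n (c • g) = c • psiO n g := by
  funext i
  simp only [psiO, Pi.smul_apply, smul_eq_mul, ← mul_neg, pp_mul _ _ hc, hx_mul _ _ _ hc,
    mn_mul _ _ _ hc]
  split_ifs <;> rfl

lemma psiE_mul (n : ℕ) (c : ℝ) (hc : 0 < c) (g : ℕ → ℝ) : psiE n (c • g) = c • psiE n g := by
  funext i
  simp only [psiE, Pi.smul_apply, smul_eq_mul, ← mul_neg, pp_mul _ _ hc]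
  split_ifs <;> simp

lemma psiO_vals (n : ℕ) (hn : 3 ≤ n) (y : ℕ → ℝ) :
    psiO n y (n - 1) = hx (y (n - 1)) (y n) ∧ psiO n y n = hx (y n) (y (n - 1)) ∧
    psiO n y (n + 1) = mn (y (n - 1)) (y n) ∧ psiO n y (2 * n) = hx (-y (n - 1)) (-y n) ∧
    psiO n y (2 * n + 1) = hx (-y n) (-y (n - 1)) ∧ psiO n y (2 * n + 2) = mn (y n) (y (n - 1)) ∧
    (∀ i, i ≤ n - 2 → psiO n y i = pp (y i)) ∧
    (∀ i, 1 ≤ i → i ≤ n - 2 → psiO n y (n + 1 + i) = pp (-y i)) := by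
  refine ⟨?_, ?_, ?_, ?_, ?_, ?_, fun i hi => ?_, fun i h1 hi => ?_⟩
  · simp only [psiO, if_true]
  · simp only [psiO, if_true, show n ≠ n - 1 by omega, if_false]
  · simp only [psiO, if_true, show n + 1 ≠ n - 1 by omega, show n + 1 ≠ n by omega, if_false]
  · simp only [psiO, if_true, show 2 * n ≠ n - 1 by omega, show 2 * n ≠ n by omega,
      show 2 * n ≠ n + 1 by omega, if_false]
  · simp only [psiO, if_true, show 2 * n + 1 ≠ n - 1 by omega, show 2 * n + 1 ≠ n by omega,
      show 2 * n + 1 ≠ n + 1 by omega, show 2 * n + 1 ≠ 2 * n by omega, if_false]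
  · simp only [psiO, if_true, show 2 * n + 2 ≠ n - 1 by omega, show 2 * n + 2 ≠ n by omega,
      show 2 * n + 2 ≠ n + 1 by omega, show 2 * n + 2 ≠ 2 * n by omega,
      show 2 * n + 2 ≠ 2 * n + 1 by omega, if_false]
  · unfold psiO
    rw [if_neg (by omega), if_neg (by omega), if_neg (by omega), if_neg (by omega),
      if_neg (by omega), if_neg (by omega), if_pos (by omega)]
  · unfold psiO
    rw [if_neg (by omega), if_neg (by omega), if_neg (by omega), if_neg (by omega),
      if_neg (by omega), if_neg (by omega), if_neg (by omega), Nat.add_sub_cancel_left]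

lemma psiE_vals (n : ℕ) (hn : 3 ≤ n) (y : ℕ → ℝ) :
    psiE n y n = 0 ∧ psiE n y (2 * n + 1) = 0 ∧
    (∀ i, i ≤ n - 1 → psiE n y i = pp (y i)) ∧
    (∀ i, i ≤ n - 1 → psiE n y (n + 1 + i) = pp (-y i)) := by
  refine ⟨by simp [psiE], by simp [psiE], fun i hi => ?_, fun i hi => ?_⟩
  · unfold psiE
    rw [if_neg (by omega), if_pos (by omega)]
  · unfold psiE
    rw [if_neg (by omega), if_neg (by omega), Nat.add_sub_cancel_left]

lemma odd_case (n : ℕ) (hn : 3 ≤ n) (T : Finset ℕ)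
    (hT : T ⊆ Finset.Icc 1 n) (h1 : n - 1 ∈ T) (h2 : n ∈ T) (ho : ¬ Even T.card) :
      Nonempty (ContinuousMap.HomotopyEquiv
        (GeomReal (2 * n + 3) (fun t => hexFace n t ∧ t ⊆ chi''Supp n T))
        (Metric.sphere (0 : EuclideanSpace ℝ (Fin T.card)) 1)) := by
  have hT' : ∀ i ∈ T, 1 ≤ i ∧ i ≤ n := fun i hi => Finset.mem_Icc.1 (hT hi)
  have hinv : ∀ g, QQ n T g → psiO n (phiO n T g) = g := by
    intro g ⟨g0, gs, gi, gh⟩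
    have hx0 : phiO n T g (n - 1) = g (n - 1) - g (2 * n) + g (n + 1) - g (2 * n + 2) := by
      simp [phiO, h1]
    have hw0 : phiO n T g n = g n - g (2 * n + 1) - g (n + 1) + g (2 * n + 2) := by
      simp [phiO, h2, show n ≠ n - 1 by omega]
    have hi0 : ∀ i, 1 ≤ i → i ≤ n - 2 → phiO n T g i = g i - g (n + 1 + i) := by
      intro i hi hi'
      unfold phiO
      by_cases hiT : i ∈ T
      · rw [if_pos hiT, if_neg (by omega), if_neg (by omega)]
      · rw [if_neg hiT, gs i, gs (n + 1 + i), sub_zero]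
        · rintro (h | h | h)
          · have := hT' _ h; omega
          · rw [Nat.add_sub_cancel_left] at h; exact hiT h.2
          · omega
        · rintro (h | h | h)
          · exact hiT h
          · omega
          · omega
    obtain ⟨e1, e2, e3, e4, e5, e6⟩ := hex_inv _ _ _ _ _ _ (g0 (n + 1)) (g0 (n - 1)) (g0 n)
      (g0 (2 * n + 2)) (g0 (2 * n)) (g0 (2 * n + 1)) gh _ _ hx0 hw0
    obtain ⟨v1, v2, v3, v4, v5, v6, v7, v8⟩ := psiO_vals n hn (phiO n T g)
    funext k
    by_cases k1 : k = n - 1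
    · rw [k1, v1, e2]
    by_cases k2 : k = n
    · rw [k2, v2, e3]
    by_cases k3 : k = n + 1
    · rw [k3, v3, e1]
    by_cases k4 : k = 2 * n
    · rw [k4, v4, e5]
    by_cases k5 : k = 2 * n + 1
    · rw [k5, v5, e6]
    by_cases k6 : k = 2 * n + 2
    · rw [k6, v6, e4]
    by_cases k7 : k = 0
    · have n0 : 0 ∉ T := fun h => by have := hT' _ h; omega
      rw [k7, v7 0 (by omega), gs 0]
      · simp [phiO, n0, pp_zero]
      · rintro (h | h | h)
        · exact n0 h
        · omega
        · omega
    by_cases k8 : k ≤ n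
    · rw [v7 k (by omega), hi0 k (by omega) (by omega)]
      exact (pp_pair _ _ (g0 _) (g0 _) (gi k (by omega) (by omega))).1
    by_cases k9 : k ≤ 2 * n + 2
    · obtain ⟨i, rfl⟩ : ∃ i, k = n + 1 + i := ⟨k - (n + 1), by omega⟩
      rw [v8 i (by omega) (by omega), hi0 i (by omega) (by omega)]
      exact (pp_pair _ _ (g0 _) (g0 _) (gi i (by omega) (by omega))).2
    · rw [QQ_zero n T hT g ⟨g0, gs, gi, gh⟩ k (by omega)]
      have n0 : k - (n + 1) ∉ T := fun h => by have := hT' _ h; omega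
      simp [psiO, k1, k2, k3, k4, k5, k6, k8, phiO, n0, pp_zero]
  refine nat_equiv (2 * n + 3) T.card _ T rfl (QQ n T)
    (fun g _ s hs => QQ_iff n hn T hT g s hs) (QQ_zero n T hT) (phiO n T) (psiO n)
    (phiO_cont n T) (psiO_cont n) (fun c f _ => phiO_mul n T c f)
    (fun c f hc => psiO_mul n c hc f) ?_ ?_ ?_ ?_ ?_
  · intro y hy
    obtain ⟨v1, v2, v3, v4, v5, v6, v7, v8⟩ := psiO_vals n hn y
    refine ⟨?_, ?_, ?_, ?_⟩
    · intro k
      unfold psiO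
      split_ifs <;> first | exact hx_nonneg _ _ | exact mn_nonneg _ _ | exact pp_nonneg _
    · intro k hk
      push Not at hk
      obtain ⟨hk1, hk2, hk3⟩ := hk
      have hk3 := hk3 ho
      have c1 : k ≠ n - 1 := fun h => hk1 (h ▸ h1)
      have c2 : k ≠ n := fun h => hk1 (h ▸ h2)
      have c4 : k ≠ 2 * n := fun h => hk2 (by omega) (by
        rw [h, show 2 * n - (n + 1) = n - 1 by omega]; exact h1)
      have c5 : k ≠ 2 * n + 1 := fun h => hk2 (by omega) (by
        rw [h, show 2 * n + 1 - (n + 1) = n by omega]; exact h2)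
      unfold psiO
      rw [if_neg c1, if_neg c2, if_neg hk3.1, if_neg c4, if_neg c5, if_neg hk3.2]
      split_ifs with h
      · rw [hy k hk1, pp_zero]
      · rw [hy _ (hk2 (by omega)), neg_zero, pp_zero]
    · intro i hi hi'
      rw [v7 i hi', v8 i hi hi']
      exact pp_or _
    · rw [v1, v2, v3, v4, v5, v6]
      exact hex_or _ _
  · intro y hy k hk
    obtain ⟨v1, v2, v3, v4, v5, v6, v7, v8⟩ := psiO_vals n hn y
    unfold phiO
    rw [if_pos hk]
    split_ifs with c1 c2
    · rw [v1, v4, v3, v6, c1]; exact hex_x _ _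
    · rw [v2, v5, v3, v6, c2]; exact hex_w _ _
    · have := hT' k hk
      rw [v7 k (by omega), v8 k (by omega) (by omega)]
      exact pp_sub _
  · intro g k hk
    simp [phiO, hk]
  · intro g hg h
    rw [← hinv g hg, h]
    funext k
    simp [psiO, pp, hx, mn]
  · intro g hg a b ha hb
    rw [hinv g hg, ← add_smul]
    obtain ⟨g0, gs, gi, p1, p2, p3, p4, p5, p6, p7, p8, p9⟩ := hg
    have hz : ∀ u v, (g u = 0 ∨ g v = 0) → (((a + b) • g) u = 0 ∨ ((a + b) • g) v = 0) := by
      rintro u v (h | h)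
      · left; simp [h]
      · right; simp [h]
    exact ⟨fun k => mul_nonneg (add_nonneg ha hb) (g0 k), fun k hk => by simp [gs k hk],
      fun i hi hi' => hz _ _ (gi i hi hi'), hz _ _ p1, hz _ _ p2, hz _ _ p3, hz _ _ p4,
      hz _ _ p5, hz _ _ p6, hz _ _ p7, hz _ _ p8, hz _ _ p9⟩

lemma even_case (n : ℕ) (hn : 3 ≤ n) (T : Finset ℕ)
    (hT : T ⊆ Finset.Icc 1 n) (h1 : n - 1 ∈ T) (h2 : n ∈ T) (ho : Even T.card) :
      Nonempty (ContinuousMap.HomotopyEquiv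
        (GeomReal (2 * n + 3) (fun t => hexFace n t ∧ t ⊆ chi''Supp n T))
        (Metric.sphere (0 : EuclideanSpace ℝ (Fin (T.card - 1))) 1)) := by
  have hT' : ∀ i ∈ T, 1 ≤ i ∧ i ≤ n := fun i hi => Finset.mem_Icc.1 (hT hi)
  have h1e : n - 1 ∈ T.erase n := Finset.mem_erase.2 ⟨by omega, h1⟩
  have nT : n + 1 ∉ T := fun h => by have := hT' _ h; omega
  have nT0 : 0 ∉ T := fun h => by have := hT' _ h; omega
  have a1 : n + 1 + (n - 1) = 2 * n := by omega
  have a2 : n + 1 + (n + 1) = 2 * n + 2 := by omega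
  have hQψ : ∀ y, (∀ k, k ∉ T.erase n → y k = 0) → QQ n T (psiE n y) := by
    intro y hy
    obtain ⟨v1, v2, v3, v4⟩ := psiE_vals n hn y
    have w1 : psiE n y (n + 1) = 0 := by
      have := v4 0 (by omega)
      rw [hy 0 (by simp [nT0])] at this
      simpa [pp_zero] using this
    have w2 : psiE n y (2 * n + 2) = 0 := by
      unfold psiE
      rw [if_neg (by omega), if_neg (by omega), show 2 * n + 2 - (n + 1) = n + 1 by omega,
        hy (n + 1) (by simp [nT]), neg_zero, pp_zero]
    refine ⟨?_, ?_, ?_, ?_⟩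
    · intro k
      unfold psiE
      split_ifs <;> first | exact le_rfl | exact pp_nonneg _
    · intro k hk
      push Not at hk
      obtain ⟨hk1, hk2, -⟩ := hk
      unfold psiE
      split_ifs with c1 c2
      · rfl
      · rw [hy k (by simp [hk1]), pp_zero]
      · rw [hy _ (by simp [hk2 (by omega)]), neg_zero, pp_zero]
    · intro i hi hi'
      rw [v3 i (by omega), v4 i (by omega)]
      exact pp_or _
    · have v5 := v3 (n - 1) le_rfl
      have v6 := v4 (n - 1) le_rfl
      rw [a1] at v6
      have := pp_or (y (n - 1))
      rw [← v5, ← v6] at this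
      simp only [v1, v2, w1, w2, true_or, or_true, true_and, and_true]
      exact this
  have hi0 : ∀ g, QQ n T g → ∀ i, 1 ≤ i → i ≤ n - 2 → phiE n T g i = g i - g (n + 1 + i) := by
    intro g ⟨g0, gs, gi, gh⟩ i hi hi'
    unfold phiE
    by_cases hiT : i ∈ T
    · rw [if_pos (Finset.mem_erase.2 ⟨by omega, hiT⟩), if_neg (by omega)]
    · rw [if_neg (by simp [hiT]), gs i, gs (n + 1 + i), sub_zero]
      · rintro (h | h | h)
        · have := hT' _ h; omega
        · rw [Nat.add_sub_cancel_left] at h; exact hiT h.2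
        · omega
      · rintro (h | h | h)
        · exact hiT h
        · omega
        · omega
  have hx0 : ∀ g, phiE n T g (n - 1) = (g (n - 1) + g n) - (g (2 * n) + g (2 * n + 1)) := by
    intro g
    unfold phiE
    rw [if_pos h1e, if_pos rfl]
  have hsupp : ∀ g k, k ∉ T.erase n → phiE n T g k = 0 := fun g k hk => by
    unfold phiE; rw [if_neg hk]
  -- vertices outside the support
  have hz1 : ∀ g, QQ n T g → g (n + 1) = 0 := fun g hg => hg.2.1 _ (by
    rintro (h | h | h)
    · exact nT h
    · simp [nT0] at h
    · exact h.1 ho)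
  have hz2 : ∀ g, QQ n T g → g (2 * n + 2) = 0 := fun g hg => hg.2.1 _ (by
    rintro (h | h | h)
    · have := hT' _ h; omega
    · have := hT' _ h.2; omega
    · exact h.1 ho)
  have hdis : ∀ g, QQ n T g → (g (n - 1) = 0 ∧ g n = 0) ∨ (g (2 * n) = 0 ∧ g (2 * n + 1) = 0) := by
    rintro g ⟨g0, gs, gi, p1, p2, p3, p4, p5, p6, p7, p8, p9⟩
    grind
  refine nat_equiv (2 * n + 3) (T.card - 1) _ (T.erase n) (Finset.card_erase_of_mem h2) (QQ n T)
    (fun g _ s hs => QQ_iff n hn T hT g s hs) (QQ_zero n T hT) (phiE n T) (psiE n)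
    (phiE_cont n T) (psiE_cont n) (fun c f _ => phiE_mul n T c f)
    (fun c f hc => psiE_mul n c hc f) hQψ ?_ hsupp ?_ ?_
  · intro y hy k hk
    obtain ⟨v1, v2, v3, v4⟩ := psiE_vals n hn y
    have hk' := Finset.mem_erase.1 hk
    have := hT' k hk'.2
    unfold phiE
    rw [if_pos hk]
    split_ifs with c1
    · rw [v1, v2, ← a1, v3 _ le_rfl, v4 _ le_rfl, c1, add_zero, add_zero]
      exact pp_sub _
    · rw [v3 k (by omega), v4 k (by omega)]
      exact pp_sub _
  · intro g hg h
    have e1 := hx0 g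
    have e2 := hi0 g hg
    have e3 := hdis g hg
    have e4 := hz1 g hg
    have e5 := hz2 g hg
    have e6 := QQ_zero n T hT g hg
    obtain ⟨g0, gs, gi, -⟩ := hg
    rw [h] at e1 e2
    simp only [Pi.zero_apply] at e1 e2
    have b1 := g0 (n - 1)
    have b2 := g0 n
    have b3 := g0 (2 * n)
    have b4 := g0 (2 * n + 1)
    funext k
    rw [Pi.zero_apply]
    by_cases k1 : k = n - 1
    · rw [k1]; rcases e3 with e3 | e3 <;> linarith
    by_cases k2 : k = n
    · rw [k2]; rcases e3 with e3 | e3 <;> linarith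
    by_cases k3 : k = n + 1
    · rw [k3, e4]
    by_cases k4 : k = 2 * n
    · rw [k4]; rcases e3 with e3 | e3 <;> linarith
    by_cases k5 : k = 2 * n + 1
    · rw [k5]; rcases e3 with e3 | e3 <;> linarith
    by_cases k6 : k = 2 * n + 2
    · rw [k6, e5]
    by_cases k7 : k = 0
    · rw [k7]
      apply gs 0
      rintro (h | h | h)
      · exact nT0 h
      · omega
      · omega
    by_cases k8 : k ≤ n
    · have q := e2 k (by omega) (by omega)
      rcases gi k (by omega) (by omega) with r | r <;> linarith
    by_cases k9 : k ≤ 2 * n + 2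
    · obtain ⟨i, rfl⟩ : ∃ i, k = n + 1 + i := ⟨k - (n + 1), by omega⟩
      have q := e2 i (by omega) (by omega)
      rcases gi i (by omega) (by omega) with r | r <;> linarith
    · exact e6 k (by omega)
  · intro g hg a b ha hb
    have hg' := hQψ (phiE n T g) (hsupp g)
    set g' := psiE n (phiE n T g) with hg'def
    have e1 := hx0 g
    have e2 := hi0 g hg
    have e3 := hdis g hg
    have e4 := hz1 g hg
    have e5 := hz2 g hg
    have e4' := hz1 g' hg'
    have e5' := hz2 g' hg'
    obtain ⟨v1, v2, v3, v4⟩ := psiE_vals n hn (phiE n T g)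
    have v5 := v3 (n - 1) le_rfl
    have v6 := v4 (n - 1) le_rfl
    rw [a1] at v6
    rw [← hg'def] at v1 v2 v3 v4 v5 v6
    have hd : (g (n - 1) = 0 ∧ g n = 0 ∧ g' (n - 1) = 0) ∨
        (g (2 * n) = 0 ∧ g (2 * n + 1) = 0 ∧ g' (2 * n) = 0) := by
      have b1 := hg.1 (n - 1)
      have b2 := hg.1 n
      have b3 := hg.1 (2 * n)
      have b4 := hg.1 (2 * n + 1)
      rw [v5, v6, e1]
      rcases e3 with ⟨c1, c2⟩ | ⟨c1, c2⟩
      · left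
        refine ⟨c1, c2, max_eq_left ?_⟩
        linarith
      · right
        refine ⟨c1, c2, max_eq_left ?_⟩
        linarith
    have hsum : ∀ k, (a • g + b • g') k = a * g k + b * g' k := fun k => rfl
    refine ⟨?_, ?_, ?_, ?_⟩
    · intro k
      have := hg.1 k
      have := hg'.1 k
      rw [hsum]; positivity
    · intro k hk
      rw [hsum, hg.2.1 k hk, hg'.2.1 k hk]; simp
    · intro i hi hi'
      have r := hg.2.2.1 i hi hi'
      obtain ⟨q1, q2⟩ := pp_pair _ _ (hg.1 i) (hg.1 (n + 1 + i)) r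
      rw [← e2 i hi hi'] at q1 q2
      rw [hsum, hsum, v3 i (by omega), v4 i (by omega), q1, q2]
      rcases r with r | r <;> rw [r] <;> simp
    · simp only [hsum, v1, v2, e4, e5, e4', e5', mul_zero, add_zero, true_or, or_true, true_and,
        and_true]
      rcases hd with ⟨c1, c2, c3⟩ | ⟨c1, c2, c3⟩ <;> simp [c1, c2, c3]
/-- Let `n ≥ 3` and `T ⊆ {1,…,n}` with `{n−1, n} ⊆ T`. If `|T|` is odd,
the realization of the induced subcomplex `K''_{χ'',T}` is homotopy equivalent to
`S^{|T|−1}`; if `|T|` is even, it is homotopy equivalent to `S^{|T|−2}`. -/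
theorem geomReal_hex_subcomplex_both (n : ℕ) (hn : 3 ≤ n) (T : Finset ℕ)
    (hT : T ⊆ Finset.Icc 1 n) (h1 : n - 1 ∈ T) (h2 : n ∈ T) :
    (¬ Even T.card →
      Nonempty (ContinuousMap.HomotopyEquiv
        (GeomReal (2 * n + 3) (fun t => hexFace n t ∧ t ⊆ chi''Supp n T))
        (Metric.sphere (0 : EuclideanSpace ℝ (Fin T.card)) 1))) ∧
    (Even T.card →
      Nonempty (ContinuousMap.HomotopyEquiv
        (GeomReal (2 * n + 3) (fun t => hexFace n t ∧ t ⊆ chi''Supp n T))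
        (Metric.sphere (0 : EuclideanSpace ℝ (Fin (T.card - 1))) 1))) := by
  exact ⟨odd_case n hn T hT h1 h2, even_case n hn T hT h1 h2⟩
end

section
/- Let n ≥ 3 and let T ⊆ {1,…,n} contain exactly one of the two elements n−1 and n. Then the geometric realization of the induced subcomplex K''_{χ'',T} is homotopy equivalent to the sphere S^{|T|−1}. -/
abbrev XSp (k : ℕ) : Type :=
  {g : Fin k × Bool → ℝ // (∀ a, 0 ≤ g a) ∧ (∑ a, g a = 1) ∧
    ∀ i, g (i, true) = 0 ∨ g (i, false) = 0}

open Classical in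
theorem hequiv_X (M k : ℕ) (K : Finset ℕ → Prop) (L : Fin M → Fin k × Bool → Prop)
    (r : Fin k × Bool → Fin M) (hr : ∀ a, L (r a) a)
    (hL : ∀ v a b, L v a → L v b → a = b)
    (hK : ∀ s : Finset (Fin M), K (s.image Fin.val) ↔ (∀ v ∈ s, ∃ a, L v a) ∧
      ∀ i, ∀ v ∈ s, ∀ w ∈ s, L v (i, true) → L w (i, false) → False) :
    Nonempty (ContinuousMap.HomotopyEquiv (GeomReal M K) (XSp k)) := by
  let F : (Fin M → ℝ) → (Fin k × Bool → ℝ) := fun f a => ∑ v, if L v a then f v else 0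
  let G : (Fin k × Bool → ℝ) → (Fin M → ℝ) := fun g v => ∑ a, if v = r a then g a else 0
  have hFc : Continuous F := by
    refine continuous_pi fun a => continuous_finsetSum _ fun v _ => ?_
    split_ifs <;> fun_prop
  have hGc : Continuous G := by
    refine continuous_pi fun a => continuous_finsetSum _ fun v _ => ?_
    split_ifs <;> fun_prop
  have hF0 : ∀ f : Fin M → ℝ, (∀ v, 0 ≤ f v) → ∀ a, 0 ≤ F f a := fun f hf a =>
    Finset.sum_nonneg fun v _ => by split_ifs <;> simp [hf]
  have hG0 : ∀ g : Fin k × Bool → ℝ, (∀ v, 0 ≤ g v) → ∀ a, 0 ≤ G g a := fun f hf a =>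
    Finset.sum_nonneg fun v _ => by split_ifs <;> simp [hf]
  have hFne : ∀ (f : Fin M → ℝ) a, F f a ≠ 0 → ∃ v, L v a ∧ f v ≠ 0 := by
    intro f a h
    obtain ⟨v, -, hv⟩ := Finset.exists_ne_zero_of_sum_ne_zero h
    refine ⟨v, ?_⟩
    by_cases hl : L v a <;> simp_all
  have hGne : ∀ (g : Fin k × Bool → ℝ) v, G g v ≠ 0 → ∃ a, v = r a ∧ g a ≠ 0 := by
    intro f a h
    obtain ⟨v, -, hv⟩ := Finset.exists_ne_zero_of_sum_ne_zero h
    refine ⟨v, ?_⟩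
    by_cases hl : a = r v <;> simp_all
  have hGsum : ∀ g, ∑ v, G g v = ∑ a, g a := by
    intro g
    simp only [G]
    rw [Finset.sum_comm]
    simp
  have hFsum : ∀ f : Fin M → ℝ, (∀ v, f v ≠ 0 → ∃ a, L v a) → ∑ a, F f a = ∑ v, f v := by
    intro f hf
    simp only [F]
    rw [Finset.sum_comm]
    refine Finset.sum_congr rfl fun v _ => ?_
    by_cases h0 : f v = 0
    · simp [h0]
    · obtain ⟨a, ha⟩ := hf v h0
      rw [Finset.sum_eq_single a]
      · simp [ha]
      · intro b _ hb
        rw [if_neg]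
        exact fun h => hb (hL v b a h ha)
      · simp
  have hFG : ∀ g, F (G g) = g := by
    intro g
    funext a
    have h1 : F (G g) a = ∑ v, ∑ b, if v = r b then (if L v a then g b else 0) else 0 := by
      refine Finset.sum_congr rfl fun v _ => ?_
      split_ifs with h
      · rfl
      · simp
    rw [h1, Finset.sum_comm]
    simp only [Finset.sum_ite_eq', Finset.sum_ite_eq, Finset.mem_univ, if_true]
    rw [Finset.sum_eq_single a]
    · simp [hr]
    · intro b _ hb
      rw [if_neg]
      exact fun h => hb (hL _ b a (hr b) h)
    · simp
  have hKf : ∀ f : Fin M → ℝ, K ((Finset.univ.filter (fun v => f v ≠ 0)).image Fin.val) ↔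
      (∀ v, f v ≠ 0 → ∃ a, L v a) ∧
      ∀ i, ∀ v, f v ≠ 0 → ∀ w, f w ≠ 0 → L v (i, true) → L w (i, false) → False := by
    intro f
    have := hK (Finset.univ.filter (fun v => f v ≠ 0))
    simpa using this
  have key : ∀ f f' : Fin M → ℝ, K ((Finset.univ.filter (fun v => f v ≠ 0)).image Fin.val) →
      (∀ v, f' v ≠ 0 → ∃ a w, L v a ∧ L w a ∧ f w ≠ 0) →
      K ((Finset.univ.filter (fun v => f' v ≠ 0)).image Fin.val) := by
    intro f f' hf h
    rw [hKf] at hf ⊢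
    refine ⟨fun v hv => ?_, fun i v hv w hw hlv hlw => ?_⟩
    · obtain ⟨a, w, h1, -⟩ := h v hv
      exact ⟨a, h1⟩
    · obtain ⟨a, v', h1, h2, h3⟩ := h v hv
      obtain ⟨b, w', h4, h5, h6⟩ := h w hw
      obtain rfl := hL _ _ _ hlv h1
      obtain rfl := hL _ _ _ hlw h4
      exact hf.2 i v' h3 w' h6 h2 h5
  let FF : C(GeomReal M K, XSp k) :=
    ⟨fun f => ⟨F f.1, hF0 _ f.2.1, by
        rw [hFsum _ ((hKf _).1 f.2.2.2).1]; exact f.2.2.1, by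
        intro i
        by_contra! hc
        obtain ⟨v, h1, h2⟩ := hFne _ _ hc.1
        obtain ⟨w, h3, h4⟩ := hFne _ _ hc.2
        exact ((hKf _).1 f.2.2.2).2 i v h2 w h4 h1 h3⟩,
      Continuous.subtype_mk (hFc.comp continuous_subtype_val) _⟩
  let GG : C(XSp k, GeomReal M K) :=
    ⟨fun g => ⟨G g.1, hG0 _ g.2.1, by rw [hGsum]; exact g.2.2.1, by
        rw [hKf]
        refine ⟨fun v hv => ?_, fun i v hv w hw hlv hlw => ?_⟩
        · obtain ⟨a, rfl, h1⟩ := hGne _ _ hv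
          exact ⟨a, hr a⟩
        · obtain ⟨a, rfl, h1⟩ := hGne _ _ hv
          obtain ⟨b, rfl, h2⟩ := hGne _ _ hw
          obtain rfl := hL _ _ _ hlv (hr a)
          obtain rfl := hL _ _ _ hlw (hr b)
          rcases g.2.2.2 i with h | h <;> contradiction⟩,
      Continuous.subtype_mk (hGc.comp continuous_subtype_val) _⟩
  refine ⟨⟨FF, GG, ⟨?_⟩, ?_⟩⟩
  · refine
      { toFun := fun p => ⟨fun v => (1 - (p.1 : ℝ)) * G (F p.2.1) v + (p.1 : ℝ) * p.2.1 v,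
          ?_, ?_, ?_⟩
        continuous_toFun := ?_
        map_zero_left := ?_
        map_one_left := ?_ }
    · intro v
      have h1 := hG0 _ (hF0 _ p.2.2.1) v
      have h2 := p.2.2.1 v
      have h3 := p.1.2.1
      have h4 : (0:ℝ) ≤ 1 - p.1 := by linarith [p.1.2.2]
      positivity
    · rw [Finset.sum_add_distrib, ← Finset.mul_sum, ← Finset.mul_sum, hGsum,
        hFsum _ ((hKf _).1 p.2.2.2.2).1, p.2.2.2.1]
      ring
    · refine key p.2.1 _ p.2.2.2.2 fun v hv => ?_
      by_cases h0 : p.2.1 v = 0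
      · have hg : G (F p.2.1) v ≠ 0 := by
          intro h
          simp [h0, h] at hv
        obtain ⟨a, rfl, h1⟩ := hGne _ _ hg
        obtain ⟨w, h2, h3⟩ := hFne _ _ h1
        exact ⟨a, w, hr a, h2, h3⟩
      · obtain ⟨a, ha⟩ := ((hKf _).1 p.2.2.2.2).1 v h0
        exact ⟨a, v, ha, ha, h0⟩
    · refine Continuous.subtype_mk (continuous_pi fun v => ?_) _
      have : Continuous fun p : unitInterval × GeomReal M K => G (F p.2.1) v :=
        (continuous_apply v).comp (hGc.comp (hFc.comp (continuous_subtype_val.comp continuous_snd)))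
      have h2 : Continuous fun p : unitInterval × GeomReal M K => p.2.1 v :=
        (continuous_apply v).comp (continuous_subtype_val.comp continuous_snd)
      fun_prop
    · intro f
      apply Subtype.ext
      funext v
      simp [FF, GG]
    · intro f
      apply Subtype.ext
      funext v
      simp
  · have : FF.comp GG = ContinuousMap.id _ := by
      ext g : 1
      exact Subtype.ext (hFG g.1)
    rw [this]

theorem X_sphere (k : ℕ) :
    Nonempty (ContinuousMap.HomotopyEquiv (XSp k)
      (Metric.sphere (0 : EuclideanSpace ℝ (Fin k)) 1)) := by
  let D : XSp k → EuclideanSpace ℝ (Fin k) := fun g =>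
    WithLp.toLp 2 fun i => g.1 (i, true) - g.1 (i, false)
  have hDc : Continuous D := by
    refine (PiLp.continuous_toLp 2 _).comp (continuous_pi fun i => ?_)
    exact ((continuous_apply _).comp continuous_subtype_val).sub
      ((continuous_apply _).comp continuous_subtype_val)
  have hD0 : ∀ g, D g ≠ 0 := by
    intro g h
    have h1 : ∀ a, g.1 a = 0 := by
      rintro ⟨i, b⟩
      have h2 : g.1 (i, true) - g.1 (i, false) = 0 := by
        have := congrArg (fun x : EuclideanSpace ℝ (Fin k) => x i) h
        simpa [D] using this
      rcases g.2.2.2 i with h3 | h3 <;> cases b <;> linarith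
    have := g.2.2.1
    simp [h1] at this
  have hn0 : ∀ g, 0 < ‖D g‖ := fun g => norm_pos_iff.2 (hD0 g)
  let S : EuclideanSpace ℝ (Fin k) → ℝ := fun x => ∑ i, |x i|
  have hSc : Continuous S := by fun_prop
  have hS0 : ∀ x : EuclideanSpace ℝ (Fin k), x ≠ 0 → 0 < S x := by
    intro x hx
    have h1 : 0 ≤ S x := Finset.sum_nonneg fun i _ => abs_nonneg _
    refine lt_of_le_of_ne h1 fun h => hx ?_
    have := (Finset.sum_eq_zero_iff_of_nonneg (fun i _ => abs_nonneg (x i))).1 h.symm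
    ext i
    simpa using this i
  have hsp : ∀ x : Metric.sphere (0 : EuclideanSpace ℝ (Fin k)) 1, x.1 ≠ 0 := by
    intro x h
    have := x.2
    rw [mem_sphere_zero_iff_norm, h] at this
    simp at this
  let E : EuclideanSpace ℝ (Fin k) → (Fin k × Bool → ℝ) := fun x a =>
    (if a.2 then max (x a.1) 0 else max (-(x a.1)) 0) / S x
  let FF : C(XSp k, Metric.sphere (0 : EuclideanSpace ℝ (Fin k)) 1) :=
    ⟨fun g => ⟨‖D g‖⁻¹ • D g, by
      rw [mem_sphere_zero_iff_norm, norm_smul, norm_inv, norm_norm]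
      exact inv_mul_cancel₀ (hn0 g).ne'⟩,
     by
      refine Continuous.subtype_mk ?_ _
      exact (hDc.norm.inv₀ fun g => (hn0 g).ne').smul hDc⟩
  have hmm : ∀ t : ℝ, max t 0 + max (-t) 0 = |t| := by
    intro t
    rcases le_total 0 t with h | h
    · rw [max_eq_left h, max_eq_right (by linarith), abs_of_nonneg h, add_zero]
    · rw [max_eq_right h, max_eq_left (by linarith), abs_of_nonpos h, zero_add]
  have hms : ∀ t : ℝ, max t 0 - max (-t) 0 = t := by
    intro t
    rcases le_total 0 t with h | h
    · rw [max_eq_left h, max_eq_right (by linarith), sub_zero]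
    · rw [max_eq_right h, max_eq_left (by linarith)]; ring
  let GG : C(Metric.sphere (0 : EuclideanSpace ℝ (Fin k)) 1, XSp k) :=
    ⟨fun x => ⟨E x.1, by
      intro a
      refine div_nonneg ?_ (hS0 _ (hsp x)).le
      split_ifs <;> exact le_max_right _ _, by
      simp only [E]
      rw [← Finset.sum_div, div_eq_one_iff_eq (hS0 _ (hsp x)).ne', Fintype.sum_prod_type]
      simp [hmm, S], by
      intro i
      rcases le_total 0 (x.1 i) with h | h
      · right; simp [E, h]
      · left; simp [E, h]⟩, by
      refine Continuous.subtype_mk (continuous_pi fun a => ?_) _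
      refine Continuous.div ?_ (hSc.comp continuous_subtype_val) fun x => (hS0 _ (hsp x)).ne'
      split_ifs <;> fun_prop⟩
  refine ⟨⟨FF, GG, ?_, ?_⟩⟩
  · have : GG.comp FF = ContinuousMap.id _ := by
      ext g : 1
      apply Subtype.ext
      funext a
      obtain ⟨i, b⟩ := a
      have hN := hn0 g
      have hD : ∀ j, (‖D g‖⁻¹ • D g) j = ‖D g‖⁻¹ * (g.1 (j, true) - g.1 (j, false)) := by
        intro j; simp [D]
      have habs : ∀ j, |(‖D g‖⁻¹ • D g) j| = ‖D g‖⁻¹ * (g.1 (j, true) + g.1 (j, false)) := by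
        intro j
        rw [hD, abs_mul, abs_of_pos (inv_pos.2 hN)]
        congr 1
        have h1 := g.2.1 (j, true)
        have h2 := g.2.1 (j, false)
        rcases g.2.2.2 j with h | h
        · rw [h, zero_sub, zero_add, abs_neg, abs_of_nonneg h2]
        · rw [h, sub_zero, add_zero, abs_of_nonneg h1]
      have hSg : S (‖D g‖⁻¹ • D g) = ‖D g‖⁻¹ := by
        simp only [S, habs]
        rw [← Finset.mul_sum]
        have := g.2.2.1
        rw [Fintype.sum_prod_type] at this
        simp only [Fintype.sum_bool] at this
        rw [this, mul_one]
      change E (‖D g‖⁻¹ • D g) (i, b) = g.1 (i, b)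
      simp only [E]
      rw [hSg, hD]
      have hp := inv_pos.2 hN
      rw [div_eq_iff hp.ne']
      have h1 := g.2.1 (i, true)
      have h2 := g.2.1 (i, false)
      have h1' := mul_nonneg hp.le h1
      have h2' := mul_nonneg hp.le h2
      rcases g.2.2.2 i with h | h <;> cases b <;> simp [h] <;>
        first | (rw [max_eq_left (by assumption)]; ring) | nlinarith
    rw [this]
  · have : FF.comp GG = ContinuousMap.id _ := by
      ext x : 1
      apply Subtype.ext
      have hSx := hS0 _ (hsp x)
      have h1 : D (GG x) = (S x.1)⁻¹ • x.1 := by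
        ext i
        have := hms (x.1 i)
        simp only [D, GG, E, ContinuousMap.coe_mk, if_true, PiLp.smul_apply, smul_eq_mul]
        rw [← sub_div]
        simp [this]
        field_simp
      change ‖D (GG x)‖⁻¹ • D (GG x) = x.1
      have hx : ‖x.1‖ = 1 := by simpa using x.2
      rw [h1, norm_smul, hx, norm_inv, Real.norm_of_nonneg hSx.le, smul_smul]
      simp [hSx.ne']
    rw [this]

theorem mem_supp (n : ℕ) (T : Finset ℕ) (hT : T ⊆ Finset.Icc 1 n) (j : ℕ) :
    j ∈ chi''Supp n T ↔ j ∈ T ∨ (∃ i ∈ T, j = n + 1 + i) ∨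
      (Odd T.card ∧ (j = n + 1 ∨ j = 2 * n + 2)) := by
  have hb : ∀ i ∈ T, 1 ≤ i ∧ i ≤ n := fun i hi => Finset.mem_Icc.1 (hT hi)
  have hcard : ((T.card : ℕ) : ZMod 2) ≠ 0 ↔ Odd T.card := by
    rw [ne_eq, ZMod.natCast_eq_zero_iff_even, Nat.not_even_iff_odd]
  unfold chi''Supp
  rw [Finset.mem_filter, Finset.mem_Icc]
  by_cases h1 : j = n + 1 ∨ j = 2 * n + 2
  · have : ∑ i ∈ T, chi''Entry n i j = (T.card : ZMod 2) := by
      rw [Finset.sum_congr rfl (g := fun _ => (1 : ZMod 2))]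
      · simp
      · intro i hi
        unfold chi''Entry
        rw [if_pos]
        tauto
    rw [this, hcard]
    constructor
    · rintro ⟨-, h⟩
      exact Or.inr (Or.inr ⟨h, h1⟩)
    · rintro (h | ⟨i, hi, h⟩ | h)
      · have := hb j h
        omega
      · have := hb i hi
        omega
      · exact ⟨by omega, h.1⟩
  · by_cases h2 : j ∈ T ∨ ∃ i ∈ T, j = n + 1 + i
    · obtain ⟨i, hi, hij⟩ : ∃ i ∈ T, j = i ∨ j = n + 1 + i := by
        rcases h2 with h | ⟨i, hi, h⟩
        · exact ⟨j, h, Or.inl rfl⟩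
        · exact ⟨i, hi, Or.inr h⟩
      have hbi := hb i hi
      have : ∑ i ∈ T, chi''Entry n i j = 1 := by
        rw [Finset.sum_eq_single i]
        · unfold chi''Entry
          rw [if_pos]
          tauto
        · intro b hbT hne
          have := hb b hbT
          unfold chi''Entry
          rw [if_neg]
          omega
        · exact fun h => absurd hi h
      rw [this]
      constructor
      · intro _
        rcases h2 with h2 | h2
        · exact Or.inl h2
        · exact Or.inr (Or.inl h2)
      · intro _
        exact ⟨by omega, one_ne_zero⟩
    · have : ∑ i ∈ T, chi''Entry n i j = 0 := by
        refine Finset.sum_eq_zero fun i hi => ?_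
        unfold chi''Entry
        rw [if_neg]
        rintro (rfl | h | rfl | h)
        · exact h2 (Or.inl hi)
        · tauto
        · exact h2 (Or.inr ⟨i, hi, rfl⟩)
        · tauto
      rw [this]
      constructor
      · rintro ⟨-, h⟩
        exact absurd rfl h
      · rintro (h | h | h)
        · exact absurd (Or.inl h) h2
        · exact absurd (Or.inr h) h2
        · exact absurd h.2 h1

/-- Labels: `v` lies on the positive or negative side of the pair indexed by `i`. -/
def lab (n i0 eT eF : ℕ) (o : Prop) (v i : ℕ) : Bool → Prop
  | true => v = i ∨ (o ∧ i = i0 ∧ v = eT)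
  | false => v = n + 1 + i ∨ (o ∧ i = i0 ∧ v = eF)

set_option maxHeartbeats 2000000 in
theorem face_iff (n : ℕ) (hn : 3 ≤ n) (T : Finset ℕ) (hT : T ⊆ Finset.Icc 1 n)
    (i0 eT eF : ℕ) (hi0 : i0 ∈ T)
    (hone : (i0 = n - 1 ∧ n ∉ T ∧ eT = n + 1 ∧ eF = 2 * n + 2) ∨
      (i0 = n ∧ n - 1 ∉ T ∧ eT = 2 * n + 2 ∧ eF = n + 1)) (t : Finset ℕ) :
    (hexFace n t ∧ t ⊆ chi''Supp n T) ↔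
      (∀ v ∈ t, ∃ i ∈ T, ∃ b, lab n i0 eT eF (Odd T.card) v i b) ∧
      ∀ i ∈ T, ∀ v ∈ t, ∀ w ∈ t, lab n i0 eT eF (Odd T.card) v i true →
        lab n i0 eT eF (Odd T.card) w i false → False := by
  have hb : ∀ i ∈ T, 1 ≤ i ∧ i ≤ n := fun i hi => Finset.mem_Icc.1 (hT hi)
  have hsupp : t ⊆ chi''Supp n T ↔
      ∀ v ∈ t, ∃ i ∈ T, ∃ b, lab n i0 eT eF (Odd T.card) v i b := by
    refine forall₂_congr fun v hv => ?_
    rw [mem_supp n T hT]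
    simp only [Bool.exists_bool, lab]
    constructor
    · rintro (h | ⟨i, hi, h⟩ | ⟨ho, h⟩)
      · exact ⟨v, h, by simp⟩
      · exact ⟨i, hi, by simp [h]⟩
      · refine ⟨i0, hi0, ?_⟩
        have : v = eT ∨ v = eF := by omega
        tauto
    · rintro ⟨i, hi, (h | ⟨ho, rfl, h⟩) | (rfl | ⟨ho, rfl, h⟩)⟩
      · exact Or.inr (Or.inl ⟨i, hi, h⟩)
      · exact Or.inr (Or.inr ⟨ho, by omega⟩)
      · exact Or.inl hi
      · exact Or.inr (Or.inr ⟨ho, by omega⟩)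
  have hi : ∀ i ∈ T, i ≠ i0 → i ≤ n - 2 := by
    intro i hi hne
    have h1 := hb i hi
    have h2 : i ≠ n := by
      rintro rfl
      rcases hone with h | h
      · exact h.2.1 hi
      · omega
    have h3 : i ≠ n - 1 := by
      rintro rfl
      rcases hone with h | h
      · omega
      · exact h.2.1 hi
    omega
  rw [← hsupp, and_comm]
  refine and_congr_right fun hts => ?_
  have hmem := hsupp.1 hts
  constructor
  · rintro ⟨-, hanti, hc⟩ i hiT v hv w hw hlv hlw
    by_cases hne : i = i0
    · subst hne
      have hvc : v ∈ t ∩ hexCyc n := by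
        refine Finset.mem_inter.2 ⟨hv, ?_⟩
        simp only [lab, hexCyc, Finset.mem_insert, Finset.mem_singleton] at *
        omega
      have hwc : w ∈ t ∩ hexCyc n := by
        refine Finset.mem_inter.2 ⟨hw, ?_⟩
        simp only [lab, hexCyc, Finset.mem_insert, Finset.mem_singleton] at *
        omega
      simp only [lab] at hlv hlw
      have hv' : v = i ∨ v = eT := hlv.imp id fun h => h.2.2
      have hw' : w = n + 1 + i ∨ w = eF := hlw.imp id fun h => h.2.2
      clear hlv hlw
      rcases hc with h | ⟨a, -, h⟩ | h
      · simp [h] at hvc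
      · rw [h, Finset.mem_singleton] at hvc hwc
        omega
      · simp only [hexEdges, Finset.mem_insert, Finset.mem_singleton] at h
        rcases h with h | h | h | h | h | h <;>
          (rw [h, Finset.mem_insert, Finset.mem_singleton] at hvc hwc; omega)
    · have h1 := hb i hiT
      have h2 := hi i hiT hne
      simp only [lab, hne, false_and, and_false, or_false] at hlv hlw
      subst hlv hlw
      exact hanti v (Finset.mem_Icc.2 ⟨h1.1, h2⟩) ⟨hv, hw⟩
  · intro H
    refine ⟨fun v hv => (Finset.mem_filter.1 (hts hv)).1, ?_, ?_⟩
    · rintro i hi' ⟨h1, h2⟩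
      rw [Finset.mem_Icc] at hi'
      obtain ⟨j, hj, b, hl⟩ := hmem i h1
      have hbj := hb j hj
      have : i ∈ T := by
        cases b
        · simp only [lab] at hl; omega
        · simp only [lab] at hl
          have : i = j := by omega
          rwa [this]
      exact H i this i h1 _ h2 (Or.inl rfl) (Or.inl rfl)
    · have hcyc : ∀ v ∈ t ∩ hexCyc n, ∃ b, lab n i0 eT eF (Odd T.card) v i0 b := by
        intro v hv
        rw [Finset.mem_inter] at hv
        obtain ⟨j, hj, b, hl⟩ := hmem v hv.1
        have hbj := hb j hj
        by_cases hne : j = i0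
        · exact ⟨b, hne ▸ hl⟩
        · have := hi j hj hne
          have h2 := hv.2
          simp only [hexCyc, Finset.mem_insert, Finset.mem_singleton] at h2
          cases b <;> simp only [lab, hne, false_and, and_false, or_false] at hl <;> omega
      have hsub : ∀ a b : ℕ, a ∈ hexCyc n → b ∈ hexCyc n → ({a, b} : Finset ℕ) ∈ hexEdges n →
          (∀ v ∈ t ∩ hexCyc n, v = a ∨ v = b) →
          (t ∩ hexCyc n = ∅ ∨ (∃ a ∈ hexCyc n, t ∩ hexCyc n = {a}) ∨
            t ∩ hexCyc n ∈ hexEdges n) := by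
        intro a b ha hb' hab h
        have : t ∩ hexCyc n ⊆ {a, b} := by
          intro v hv
          simpa using h v hv
        rw [← Finset.coe_subset, Finset.coe_pair, Set.subset_pair_iff_eq] at this
        have this : t ∩ hexCyc n = ∅ ∨ t ∩ hexCyc n = {a} ∨ t ∩ hexCyc n = {b} ∨
            t ∩ hexCyc n = {a, b} := by
          rcases this with h | h | h | h
          · exact Or.inl (Finset.coe_injective (by rw [h]; simp))
          · exact Or.inr (Or.inl (Finset.coe_injective (by rw [h]; simp)))
          · exact Or.inr (Or.inr (Or.inl (Finset.coe_injective (by rw [h]; simp))))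
          · exact Or.inr (Or.inr (Or.inr (Finset.coe_injective (by rw [h]; simp))))
        rcases this with h | h | h | h
        · exact Or.inl h
        · exact Or.inr (Or.inl ⟨a, ha, h⟩)
        · exact Or.inr (Or.inl ⟨b, hb', h⟩)
        · rw [h]; exact Or.inr (Or.inr hab)
      by_cases hex : ∃ v ∈ t ∩ hexCyc n, lab n i0 eT eF (Odd T.card) v i0 true
      · obtain ⟨v, hv, hlv⟩ := hex
        refine hsub i0 eT ?_ ?_ ?_ ?_
        · simp only [hexCyc, Finset.mem_insert, Finset.mem_singleton]; omega
        · simp only [hexCyc, Finset.mem_insert, Finset.mem_singleton]; omega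
        · rcases hone with ⟨rfl, -, rfl, rfl⟩ | ⟨rfl, -, rfl, rfl⟩
          · rw [Finset.pair_comm]; simp [hexEdges]
          · simp [hexEdges]
        · intro w hw
          obtain ⟨b, hl⟩ := hcyc w hw
          cases b
          · exact (H i0 hi0 v (Finset.mem_inter.1 hv).1 w (Finset.mem_inter.1 hw).1 hlv hl).elim
          · exact hl.imp id fun h => h.2.2
      · refine hsub (n + 1 + i0) eF ?_ ?_ ?_ ?_
        · simp only [hexCyc, Finset.mem_insert, Finset.mem_singleton]; omega
        · simp only [hexCyc, Finset.mem_insert, Finset.mem_singleton]; omega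
        · rcases hone with ⟨rfl, -, rfl, rfl⟩ | ⟨rfl, -, rfl, rfl⟩
          · rw [Finset.pair_comm, show n + 1 + (n - 1) = 2 * n by omega]; simp [hexEdges]
          · rw [show i0 + 1 + i0 = 2 * i0 + 1 by omega]; simp [hexEdges]
        · intro w hw
          obtain ⟨b, hl⟩ := hcyc w hw
          cases b
          · exact hl.imp id fun h => h.2.2
          · exact (hex ⟨w, hw, hl⟩).elim

/-- Let `n ≥ 3` and let `T ⊆ {1,…,n}` contain exactly one of the two
elements `n−1` and `n`. Then the realization of the induced subcomplex `K''_{χ'',T}` is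
homotopy equivalent to the sphere `S^{|T|−1}`. -/
theorem geomReal_hex_subcomplex_one (n : ℕ) (hn : 3 ≤ n) (T : Finset ℕ)
    (hT : T ⊆ Finset.Icc 1 n)
    (hone : (n - 1 ∈ T ∧ n ∉ T) ∨ (n - 1 ∉ T ∧ n ∈ T)) :
    Nonempty (ContinuousMap.HomotopyEquiv
      (GeomReal (2 * n + 3) (fun t => hexFace n t ∧ t ⊆ chi''Supp n T))
      (Metric.sphere (0 : EuclideanSpace ℝ (Fin T.card)) 1)) := by
  have hb : ∀ i ∈ T, 1 ≤ i ∧ i ≤ n := fun i hi => Finset.mem_Icc.1 (hT hi)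
  obtain ⟨i0, eT, eF, hi0, h⟩ : ∃ i0 eT eF, i0 ∈ T ∧
      ((i0 = n - 1 ∧ n ∉ T ∧ eT = n + 1 ∧ eF = 2 * n + 2) ∨
      (i0 = n ∧ n - 1 ∉ T ∧ eT = 2 * n + 2 ∧ eF = n + 1)) := by
    rcases hone with h | h
    · exact ⟨n - 1, n + 1, 2 * n + 2, h.1, Or.inl ⟨rfl, h.2, rfl, rfl⟩⟩
    · exact ⟨n, 2 * n + 2, n + 1, h.2, Or.inr ⟨rfl, h.1, rfl, rfl⟩⟩
  let e := T.equivFin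
  obtain ⟨A⟩ := hequiv_X (2 * n + 3) T.card (fun t => hexFace n t ∧ t ⊆ chi''Supp n T)
    (fun v a => lab n i0 eT eF (Odd T.card) v.1 (e.symm a.1).1 a.2)
    (fun a => ⟨if a.2 then (e.symm a.1).1 else n + 1 + (e.symm a.1).1, by
      have := hb _ (e.symm a.1).2
      split_ifs <;> omega⟩)
    (by
      rintro ⟨i, b⟩
      cases b <;> simp [lab])
    (by
      rintro v ⟨i, b⟩ ⟨j, c⟩ h1 h2
      have hi := hb _ (e.symm i).2
      have hj := hb _ (e.symm j).2
      have hbc : b = c := by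
        cases b <;> cases c <;> simp only [lab] at h1 h2 <;> first | rfl | (exfalso; omega)
      subst hbc
      have : (e.symm i).1 = (e.symm j).1 := by
        cases b <;> simp only [lab] at h1 h2 <;> omega
      rw [Prod.mk.injEq]
      exact ⟨e.symm.injective (Subtype.ext this), rfl⟩)
    (by
      intro s
      rw [face_iff n hn T hT i0 eT eF hi0 h]
      simp only [Finset.forall_mem_image]
      refine and_congr (forall₂_congr fun v hv => ?_) ?_
      · constructor
        · rintro ⟨i, hi, b, hl⟩
          exact ⟨(e ⟨i, hi⟩, b), by simpa using hl⟩
        · rintro ⟨⟨i, b⟩, hl⟩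
          exact ⟨_, (e.symm i).2, b, hl⟩
      · constructor
        · intro H i v hv w hw
          exact H _ (e.symm i).2 hv hw
        · intro H i hi v hv w hw h1 h2
          exact H (e ⟨i, hi⟩) v hv w hw (by simpa using h1) (by simpa using h2))
  obtain ⟨B⟩ := X_sphere T.card
  exact ⟨A.trans B⟩
end
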